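/- arXiv:2406.01977 — 5 statements merged into one kernel-verified Lean document; each statement's English description precedes it below -/
import Mathlib

section
/- Let ι be a nonempty finite index set, let s : ι → ℝ, let G ⊆ ι be nonempty, and let Δ ≥ 0 be a real number. Assume that s i ≥ s j + Δ for every i ∈ G and every j ∈ ι \ G. Then the total softmax mass on G satisfies (Σ_{i∈G} exp(s i)) / (Σ_{j∈ι} exp(s j)) ≥ (|G| · exp Δ) / (|G| · exp Δ + |ι \ G|), and consequently (Σ_{i∈G} exp(s i)) / (Σ_{j∈ι} exp(s j)) ≥ 1 − (|ι \ G| · exp(−Δ)) / |G|. -/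
open Real Finset

/-- Summing the margin inequality over all pairs in `G × H` compares the exponential masses. -/
theorem card_mul_exp_mul_sum_exp_le {ι : Type*} (s : ι → ℝ) (G H : Finset ι) (Δ : ℝ)
    (hmargin : ∀ i ∈ G, ∀ j ∈ H, s j + Δ ≤ s i) :
    (G.card : ℝ) * exp Δ * ∑ j ∈ H, exp (s j) ≤ (H.card : ℝ) * ∑ i ∈ G, exp (s i) := by
  calc (G.card : ℝ) * exp Δ * ∑ j ∈ H, exp (s j)
      = ∑ _i ∈ G, ∑ j ∈ H, exp (s j + Δ) := by
        simp only [exp_add, ← sum_mul, sum_const, nsmul_eq_mul]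
        ring
    _ ≤ ∑ i ∈ G, ∑ _j ∈ H, exp (s i) :=
        sum_le_sum fun i hi => sum_le_sum fun j hj => exp_le_exp.2 (hmargin i hi j hj)
    _ = (H.card : ℝ) * ∑ i ∈ G, exp (s i) := by
        simp only [sum_const, nsmul_eq_mul, mul_sum]

/-- Softmax mass concentration on a group `G` whose scores all exceed the
remaining scores by a margin `Δ`. -/
theorem softmax_mass_on_group {ι : Type*} [Fintype ι] [DecidableEq ι] [Nonempty ι]
    (s : ι → ℝ) (G : Finset ι) (hG : G.Nonempty) (Δ : ℝ) (hΔ : 0 ≤ Δ)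
    (hmargin : ∀ i ∈ G, ∀ j ∈ univ \ G, s i ≥ s j + Δ) :
    (∑ i ∈ G, exp (s i)) / (∑ j, exp (s j)) ≥
      ((G.card : ℝ) * exp Δ) / ((G.card : ℝ) * exp Δ + ((univ \ G).card : ℝ)) ∧
    (∑ i ∈ G, exp (s i)) / (∑ j, exp (s j)) ≥
      1 - (((univ \ G).card : ℝ) * exp (-Δ)) / (G.card : ℝ) := by
  have hmass := card_mul_exp_mul_sum_exp_le s G (univ \ G) Δ hmargin
  have hsplit : ∑ j, exp (s j) = ∑ i ∈ G, exp (s i) + ∑ j ∈ univ \ G, exp (s j) := by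
    rw [add_comm, sum_sdiff (subset_univ G)]
  have hcard : (0 : ℝ) < G.card := by exact_mod_cast hG.card_pos
  have ha : 0 < (G.card : ℝ) * exp Δ := by positivity
  have hc : (0 : ℝ) ≤ (univ \ G).card := by positivity
  have htotal : 0 < ∑ j, exp (s j) := sum_pos (fun j _ => exp_pos _) univ_nonempty
  have hfirst : ((G.card : ℝ) * exp Δ) / ((G.card : ℝ) * exp Δ + ((univ \ G).card : ℝ)) ≤
      (∑ i ∈ G, exp (s i)) / (∑ j, exp (s j)) := by
    rw [div_le_div_iff₀ (by positivity) htotal, hsplit]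
    linarith
  refine ⟨hfirst, le_trans ?_ hfirst⟩
  have hratio : ((univ \ G).card : ℝ) * exp (-Δ) / G.card =
      (univ \ G).card / ((G.card : ℝ) * exp Δ) := by
    rw [exp_neg]
    field_simp
  rw [hratio, one_sub_div ha.ne', div_le_div_iff₀ ha (by positivity)]
  nlinarith [sq_nonneg ((univ \ G).card : ℝ)]
end

section
/- Let ι be a nonempty finite index set, let s : ι → ℝ, let G ⊆ ι be nonempty, and let Δ ≥ 0 be a real number. Assume that s i ≥ s j + Δ for every i ∈ G and every j ∈ ι \ G. Then for every j ∈ ι \ G the individual softmax weight satisfies exp(s j) / (Σ_{k∈ι} exp(s k)) ≤ exp(−Δ) / |G|. -/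
open Real Finset

/-- Each softmax weight outside a group `G` whose scores all exceed the
remaining scores by a margin `Δ` is at most `exp (-Δ) / |G|`. -/
theorem softmax_weight_off_group {ι : Type*} [Fintype ι] [DecidableEq ι] [Nonempty ι]
    (s : ι → ℝ) (G : Finset ι) (hG : G.Nonempty) (Δ : ℝ) (hΔ : 0 ≤ Δ)
    (hmargin : ∀ i ∈ G, ∀ j ∈ univ \ G, s i ≥ s j + Δ) :
    ∀ j ∈ univ \ G, exp (s j) / (∑ k, exp (s k)) ≤ exp (-Δ) / (G.card : ℝ) := by
  intro j hj
  have hcard : (0 : ℝ) < G.card := by exact_mod_cast hG.card_pos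
  have hsum : (0 : ℝ) < ∑ k, exp (s k) := sum_pos (fun k _ => exp_pos (s k)) univ_nonempty
  rw [div_le_div_iff₀ hsum hcard]
  calc exp (s j) * G.card = exp (-Δ) * (G.card • exp (s j + Δ)) := by
        rw [nsmul_eq_mul, mul_left_comm, ← exp_add, neg_add_cancel_comm_assoc, mul_comm]
    _ ≤ exp (-Δ) * ∑ k ∈ G, exp (s k) := by
        gcongr
        exact card_nsmul_le_sum G _ _ fun i hi => exp_le_exp.mpr (hmargin i hi j hj)
    _ ≤ exp (-Δ) * ∑ k, exp (s k) := by
        gcongr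
        exact subset_univ G
end

section
/- Let a ≥ 0, b ≥ 0 and ξ ≥ 0 be real numbers, and let y : ℝ → ℝ be a function with y 0 = ξ such that for every t ∈ ℝ, y has derivative a + b·t·(y t) at t. Then for every t ≥ 0, y t ≥ ξ · exp(b·t²/2), and in particular y t ≥ ξ · (1 + b·t²/2). -/
open Real

/-- Multiplying a solution of `y' t = a + b * t * y t` by the integrating factor
`exp (-(b * t ^ 2 / 2))` gives a monotone function when `0 ≤ a`. -/
theorem monotone_mul_integrating_factor {a b : ℝ} (ha : 0 ≤ a) {y : ℝ → ℝ}
    (hy : ∀ t : ℝ, HasDerivAt y (a + b * t * y t) t) :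
    Monotone fun t => y t * exp (-(b * t ^ 2 / 2)) := by
  refine monotone_of_hasDerivAt_nonneg (f' := fun t => a * exp (-(b * t ^ 2 / 2)))
    (fun t => ?_) (fun t => by positivity)
  have hsq : HasDerivAt (fun t : ℝ => -(b * t ^ 2 / 2)) (-(b * t)) t := by
    refine (((hasDerivAt_pow 2 t).const_mul b).div_const 2).neg.congr_deriv ?_
    push_cast
    ring
  exact ((hy t).mul hsq.exp).congr_deriv (by ring)

/-- Gronwall-type lower bound for the linear ODE `y' t = a + b * t * y t` with
nonnegative coefficients and nonnegative initial value `ξ`. -/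
theorem linear_ode_growth_lower_bound (a b ξ : ℝ)
    (ha : 0 ≤ a) (hb : 0 ≤ b) (hξ : 0 ≤ ξ)
    (y : ℝ → ℝ) (hy0 : y 0 = ξ)
    (hy : ∀ t : ℝ, HasDerivAt y (a + b * t * y t) t) :
    ∀ t : ℝ, 0 ≤ t →
      ξ * exp (b * t ^ 2 / 2) ≤ y t ∧ ξ * (1 + b * t ^ 2 / 2) ≤ y t := by
  intro t ht
  have hmono := monotone_mul_integrating_factor ha hy ht
  have hexp : ξ * exp (b * t ^ 2 / 2) ≤ y t := by
    have hξt : ξ ≤ y t * exp (-(b * t ^ 2 / 2)) := by simpa [hy0] using hmono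
    rwa [exp_neg, ← div_eq_mul_inv, le_div_iff₀ (exp_pos _)] at hξt
  refine ⟨hexp, le_trans (mul_le_mul_of_nonneg_left ?_ hξ) hexp⟩
  linarith [add_one_le_exp (b * t ^ 2 / 2)]
end

section
/- Let T be a natural number with T ≥ 1 and let x be a real number satisfying x = (1 + exp(−x²))^T. Then √((log T)/2) ≤ x ≤ 2^T. -/
open Real

/-- Two-sided bound `√(log T / 2) ≤ x ≤ 2 ^ T` for a solution of the
self-consistency relation `x = (1 + exp (-x²))^T`. -/
theorem self_consistency_bounds (T : ℕ) (hT : 1 ≤ T) (x : ℝ)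
    (hx : x = (1 + exp (-x ^ 2)) ^ T) :
    Real.sqrt (Real.log T / 2) ≤ x ∧ x ≤ 2 ^ T := by
  have hpos : 0 < exp (-x ^ 2) := exp_pos _
  have hle : exp (-x ^ 2) ≤ 1 := exp_le_one_iff.2 (neg_nonpos.2 (sq_nonneg x))
  have hx0 : 0 ≤ x := hx ▸ by positivity
  constructor
  · rw [Real.sqrt_le_left hx0]
    by_contra! h
    have hT0 : (0 : ℝ) < T := by exact_mod_cast hT
    have hlog : exp (x ^ 2 + x ^ 2) < T := (lt_log_iff_exp_lt hT0).1 (by linarith)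
    have bernoulli : 1 + T * exp (-x ^ 2) ≤ x :=
      (one_add_mul_le_pow (by linarith) T).trans_eq hx.symm
    have hexp : exp (x ^ 2) < T * exp (-x ^ 2) :=
      calc exp (x ^ 2) = exp (x ^ 2 + x ^ 2) * exp (-x ^ 2) := by rw [← exp_add]; ring_nf
        _ < T * exp (-x ^ 2) := by gcongr
    nlinarith [add_one_le_exp (x ^ 2), sq_nonneg (x - 1)]
  · calc x = (1 + exp (-x ^ 2)) ^ T := hx
      _ ≤ 2 ^ T := by gcongr; linarith
end

section
/- Let ι be a nonempty finite index set, let s : ι → ℝ, let G ⊆ ι be nonempty, and let Δ ≥ 0. Assume s i ≥ s j + Δ for every i ∈ G and every j ∈ ι \ G. Let E be a real normed vector space, let x : ι → E, let p⋆ ∈ E and R ≥ 0, and assume x i = p⋆ for every i ∈ G and ‖x j − p⋆‖ ≤ R for every j ∈ ι \ G. Then the softmax-weighted average satisfies ‖(Σ_{i∈ι} (exp(s i)/Σ_{j∈ι} exp(s j)) • x i) − p⋆‖ ≤ R · |ι \ G| · exp(−Δ) / |G|. -/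
open Real Finset

/-- The softmax weights sum to one. -/
lemma sum_exp_div_sum_exp {ι : Type*} [Fintype ι] [Nonempty ι] (s : ι → ℝ) :
    ∑ i, exp (s i) / ∑ j, exp (s j) = 1 := by
  rw [← sum_div]
  exact div_self (sum_pos (fun j _ => Real.exp_pos (s j)) univ_nonempty).ne'

/-- If every score in `G` exceeds `s j` by at least `Δ`, then the softmax weight of `j` is at
most `exp (-Δ) / |G|`. -/
lemma exp_div_sum_exp_le {ι : Type*} [Fintype ι] (s : ι → ℝ) {G : Finset ι} (hG : G.Nonempty)
    {Δ : ℝ} {j : ι} (h : ∀ i ∈ G, s j + Δ ≤ s i) :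
    exp (s j) / ∑ k, exp (s k) ≤ exp (-Δ) / (G.card : ℝ) := by
  have hcard : (0 : ℝ) < G.card := Nat.cast_pos.2 hG.card_pos
  have hsum : (G.card : ℝ) * exp (s j + Δ) ≤ ∑ k, exp (s k) := by
    calc (G.card : ℝ) * exp (s j + Δ) = ∑ _i ∈ G, exp (s j + Δ) := by simp
      _ ≤ ∑ i ∈ G, exp (s i) := sum_le_sum fun i hi => Real.exp_le_exp.2 (h i hi)
      _ ≤ ∑ k, exp (s k) :=
        sum_le_sum_of_subset_of_nonneg (subset_univ G)
          fun k _ _ => (Real.exp_pos (s k)).le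
  have hpos : 0 < (G.card : ℝ) * exp (s j + Δ) := mul_pos hcard (Real.exp_pos _)
  rw [div_le_div_iff₀ (hpos.trans_le hsum) hcard]
  calc exp (s j) * (G.card : ℝ)
      = exp (-Δ) * ((G.card : ℝ) * exp (s j + Δ)) := by
        rw [mul_left_comm, ← Real.exp_add, neg_add_cancel_comm_assoc, mul_comm]
    _ ≤ exp (-Δ) * ∑ k, exp (s k) :=
        mul_le_mul_of_nonneg_left hsum (Real.exp_pos _).le

/-- Sparse attention plus value aggregation: when all tokens in `G` share the
feature `p⋆` and their scores exceed all other scores by `Δ`, the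
softmax-weighted average is within `R * |ι \ G| * exp (-Δ) / |G|` of `p⋆`. -/
theorem softmax_attention_output_close
    {ι : Type*} [Fintype ι] [DecidableEq ι] [Nonempty ι]
    (s : ι → ℝ) (G : Finset ι) (hG : G.Nonempty) (Δ : ℝ) (hΔ : 0 ≤ Δ)
    (hmargin : ∀ i ∈ G, ∀ j ∈ univ \ G, s i ≥ s j + Δ)
    {E : Type*} [NormedAddCommGroup E] [NormedSpace ℝ E]
    (x : ι → E) (pstar : E) (R : ℝ) (hR : 0 ≤ R)
    (hxG : ∀ i ∈ G, x i = pstar) (hxout : ∀ j ∈ univ \ G, ‖x j - pstar‖ ≤ R) :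
    ‖(∑ i, (exp (s i) / ∑ j, exp (s j)) • x i) - pstar‖ ≤
      R * ((univ \ G).card : ℝ) * exp (-Δ) / (G.card : ℝ) := by
  have hdiff : (∑ i, (exp (s i) / ∑ j, exp (s j)) • x i) - pstar =
      ∑ i ∈ univ \ G, (exp (s i) / ∑ j, exp (s j)) • (x i - pstar) := by
    have hsub : ∑ i ∈ univ \ G, (exp (s i) / ∑ j, exp (s j)) • (x i - pstar) =
        ∑ i, (exp (s i) / ∑ j, exp (s j)) • (x i - pstar) :=
      sum_subset (subset_univ _) fun i _ hi => by
        rw [hxG i (by simpa using hi), sub_self, smul_zero]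
    rw [hsub]
    simp only [smul_sub, sum_sub_distrib, ← sum_smul, sum_exp_div_sum_exp, one_smul]
  rw [hdiff]
  calc ‖∑ i ∈ univ \ G, (exp (s i) / ∑ j, exp (s j)) • (x i - pstar)‖
      ≤ ∑ _i ∈ univ \ G, exp (-Δ) / (G.card : ℝ) * R := by
        refine norm_sum_le_of_le _ fun j hj => ?_
        have hweight : 0 ≤ exp (s j) / ∑ k, exp (s k) := by positivity
        rw [norm_smul, Real.norm_of_nonneg hweight]
        exact mul_le_mul (exp_div_sum_exp_le s hG fun i hi => hmargin i hi j hj) (hxout j hj)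
          (norm_nonneg _) (by positivity)
    _ = R * ((univ \ G).card : ℝ) * exp (-Δ) / (G.card : ℝ) := by
        rw [sum_const, nsmul_eq_mul]
        ring
end
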